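/- With $H$ as above ($H$ even, $H(0)=1$ the max, $H(\pm1)=0$ the min, $H''(0)<0$, $H''(1)>0$) and $\tau_\varepsilon = \varepsilon e^{1/\varepsilon}$, the minimal transition cost $k_\varepsilon := \min\{\tau_\varepsilon \int_{-1}^1 (\varphi')^2\, d\tilde\gamma_\varepsilon : \varphi \in W^{1,2}(-1,1),\ \varphi(\pm1) = \pm 1/2\}$ satisfies $\lim_{\varepsilon \to 0^+} k_\varepsilon = \sqrt{|H''(0)|\,H''(1)}/(2\pi)$. -/

import Mathlib

open MeasureTheory Filter Set Topology

lemma tendsto_sub_div_sq_of_derivWithin_eq_zero {g : ℝ → ℝ} {s : Set ℝ} {x₀ : ℝ}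
    (hs : Convex ℝ s) (hx₀ : x₀ ∈ s) (hg : ContDiffOn ℝ 2 g s) (hd : derivWithin g s x₀ = 0) :
    Tendsto (fun x => (g x - g x₀) / (x - x₀) ^ 2) (𝓝[s \ {x₀}] x₀)
      (𝓝 (iteratedDerivWithin 2 g s x₀ / 2)) := by
  have h := (taylor_isLittleO hs hx₀ (n := 2) hg).mono
    (nhdsWithin_mono x₀ (sdiff_subset (t := {x₀})))
  have h' := h.tendsto_div_nhds_zero.add_const (iteratedDerivWithin 2 g s x₀ / 2)
  rw [zero_add] at h'
  refine h'.congr' ?_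
  filter_upwards [self_mem_nhdsWithin] with x hx
  have hne : x - x₀ ≠ 0 := sub_ne_zero.2 hx.2
  simp only [taylorWithinEval_succ, taylor_within_zero_eval, iteratedDerivWithin_one, hd,
    smul_eq_mul, zero_add]
  norm_num
  field_simp
  ring

lemma exists_mul_sq_le_of_tendsto {f : ℝ → ℝ} {a : ℝ} (ha : 0 < a)
    (hf : ContinuousOn f (Icc 0 1)) (hpos : ∀ x ∈ Ioc (0 : ℝ) 1, 0 < f x)
    (hlim : Tendsto (fun x => f x / x ^ 2) (𝓝[>] 0) (𝓝 a)) :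
    ∃ c > 0, ∀ x ∈ Ioc (0 : ℝ) 1, c * x ^ 2 ≤ f x := by
  have hev := hlim.eventually_const_le (show a / 2 < a by linarith)
  obtain ⟨δ, hδ, hδf⟩ := mem_nhdsGT_iff_exists_Ioo_subset.1 hev
  have hδ' : (0 : ℝ) < δ := hδ
  rcases (Icc δ 1).eq_empty_or_nonempty with hE | hne
  · refine ⟨a / 2, by positivity, fun x hx => ?_⟩
    have hx' : x < δ := by
      by_contra! hcon
      exact (hE ▸ (⟨hcon, hx.2⟩ : x ∈ Icc δ 1) : x ∈ (∅ : Set ℝ))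
    have : a / 2 ≤ f x / x ^ 2 := hδf ⟨hx.1, hx'⟩
    rwa [le_div_iff₀ (pow_pos hx.1 2)] at this
  · obtain ⟨m, hm, hmin⟩ := isCompact_Icc.exists_isMinOn hne
      (hf.mono (Icc_subset_Icc_left hδ'.le))
    have hfm : 0 < f m := hpos m ⟨hδ'.trans_le hm.1, hm.2⟩
    refine ⟨min (a / 2) (f m), lt_min (by positivity) hfm, fun x hx => ?_⟩
    rcases lt_or_ge x δ with hx' | hx'
    · have : a / 2 ≤ f x / x ^ 2 := hδf ⟨hx.1, hx'⟩
      rw [le_div_iff₀ (pow_pos hx.1 2)] at this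
      exact (mul_le_mul_of_nonneg_right (min_le_left _ _) (sq_nonneg x)).trans this
    · have h1 : f m ≤ f x := hmin ⟨hx', hx.2⟩
      have h2 : x ^ 2 ≤ 1 := pow_le_one₀ hx.1.le hx.2
      calc min (a / 2) (f m) * x ^ 2 ≤ f m * x ^ 2 :=
            mul_le_mul_of_nonneg_right (min_le_right _ _) (sq_nonneg x)
        _ ≤ f m := mul_le_of_le_one_right hfm.le h2
        _ ≤ f x := h1

/-- One-sided Laplace asymptotics at a quadratic boundary minimum. -/
lemma tendsto_laplace_half {f : ℝ → ℝ} {a : ℝ} (ha : 0 < a)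
    (hf : ContinuousOn f (Icc 0 1)) (hpos : ∀ x ∈ Ioc (0 : ℝ) 1, 0 < f x)
    (hlim : Tendsto (fun x => f x / x ^ 2) (𝓝[>] 0) (𝓝 a)) :
    Tendsto (fun ε : ℝ => (√ε)⁻¹ * ∫ x in (0 : ℝ)..1, Real.exp (-f x / ε)) (𝓝[>] 0)
      (𝓝 (√(Real.pi / a) / 2)) := by
  obtain ⟨c, hc, hcf⟩ := exists_mul_sq_le_of_tendsto ha hf hpos hlim
  rw [← integral_gaussian_Ioi a]
  have key : ∀ ε : ℝ, 0 < ε → (√ε)⁻¹ * ∫ x in (0 : ℝ)..1, Real.exp (-f x / ε) =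
      ∫ y in Ioi (0 : ℝ), (Ioc 0 (√ε)⁻¹).indicator (fun y => Real.exp (-f (√ε * y) / ε)) y := by
    intro ε hε
    have hs : 0 < √ε := Real.sqrt_pos.2 hε
    rw [setIntegral_indicator measurableSet_Ioc,
      inter_eq_self_of_subset_right Ioc_subset_Ioi_self,
      ← intervalIntegral.integral_of_le (inv_pos.2 hs).le,
      intervalIntegral.integral_comp_mul_left (fun x => Real.exp (-f x / ε)) hs.ne']
    simp [hs.ne']
  refine Tendsto.congr' (f₁ := fun ε : ℝ => ∫ y in Ioi (0 : ℝ),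
    (Ioc 0 (√ε)⁻¹).indicator (fun y => Real.exp (-f (√ε * y) / ε)) y) ?_ ?_
  · filter_upwards [self_mem_nhdsWithin] with ε hε using (key ε hε).symm
  have hsqrt : Tendsto (fun ε : ℝ => √ε) (𝓝[>] 0) (𝓝[>] 0) := by
    refine tendsto_nhdsWithin_iff.2 ⟨?_, ?_⟩
    · simpa using (Real.continuous_sqrt.tendsto 0).mono_left nhdsWithin_le_nhds
    · filter_upwards [self_mem_nhdsWithin] with ε hε using Real.sqrt_pos.2 hε
  have hmem : ∀ {ε y : ℝ}, 0 < ε → y ∈ Ioc 0 (√ε)⁻¹ → √ε * y ∈ Ioc (0 : ℝ) 1 := by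
    intro ε y hε hy
    have hs : 0 < √ε := Real.sqrt_pos.2 hε
    refine ⟨mul_pos hs hy.1, ?_⟩
    calc √ε * y ≤ √ε * (√ε)⁻¹ := mul_le_mul_of_nonneg_left hy.2 hs.le
      _ = 1 := mul_inv_cancel₀ hs.ne'
  refine tendsto_integral_filter_of_dominated_convergence (fun y => Real.exp (-c * y ^ 2)) ?_ ?_
    (integrable_exp_neg_mul_sq hc).integrableOn ?_
  · filter_upwards [self_mem_nhdsWithin] with ε hε
    have hcont : ContinuousOn (fun y => Real.exp (-f (√ε * y) / ε)) (Ioc 0 (√ε)⁻¹) := by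
      have : ContinuousOn (fun y => f (√ε * y)) (Ioc 0 (√ε)⁻¹) :=
        hf.comp (by fun_prop) fun y hy => Ioc_subset_Icc_self (hmem hε hy)
      exact Real.continuous_exp.comp_continuousOn (this.neg.div_const ε)
    exact ((aestronglyMeasurable_indicator_iff measurableSet_Ioc).2
      (hcont.aestronglyMeasurable measurableSet_Ioc)).restrict
  · filter_upwards [self_mem_nhdsWithin] with ε hε
    refine Eventually.of_forall fun y => ?_
    by_cases hy : y ∈ Ioc 0 (√ε)⁻¹
    · rw [indicator_of_mem hy, Real.norm_eq_abs, Real.abs_exp, Real.exp_le_exp]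
      have h := hcf _ (hmem hε hy)
      rw [mul_pow, Real.sq_sqrt (le_of_lt hε)] at h
      rw [div_le_iff₀ hε]
      linarith
    · rw [indicator_of_notMem hy, norm_zero]
      positivity
  · filter_upwards [ae_restrict_mem measurableSet_Ioi] with y hy
    have hy0 : (0 : ℝ) < y := hy
    have hsy : Tendsto (fun ε : ℝ => √ε * y) (𝓝[>] 0) (𝓝[>] 0) := by
      have hsqrt' := tendsto_nhdsWithin_iff.1 hsqrt
      refine tendsto_nhdsWithin_iff.2 ⟨by simpa using hsqrt'.1.mul_const y, ?_⟩
      filter_upwards [self_mem_nhdsWithin] with ε hε using mul_pos (Real.sqrt_pos.2 hε) hy0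
    have hL : Tendsto (fun ε : ℝ => Real.exp (-(f (√ε * y) / (√ε * y) ^ 2 * y ^ 2))) (𝓝[>] 0)
        (𝓝 (Real.exp (-a * y ^ 2))) := by
      have := ((hlim.comp hsy).mul_const (y ^ 2)).neg
      rw [neg_mul]
      exact (Real.continuous_exp.tendsto _).comp this
    refine hL.congr' ?_
    filter_upwards [self_mem_nhdsWithin, (tendsto_inv_nhdsGT_zero.comp hsqrt).eventually_ge_atTop y]
      with ε hε hye
    have hε0 : (0 : ℝ) < ε := hε
    have hy' : y ∈ Ioc 0 (√ε)⁻¹ := ⟨hy0, hye⟩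
    rw [indicator_of_mem hy', mul_pow, Real.sq_sqrt hε0.le]
    congr 1
    field_simp

/-- The minimal weighted Dirichlet energy with boundary values `∓1/2` is the inverse of the
integral of the inverse weight. -/
lemma isLeast_weighted_energy {w : ℝ → ℝ} {a b C : ℝ} (hab : a < b) (hC : 0 ≤ C)
    (hw : ContinuousOn w (Icc a b)) (hpos : ∀ x ∈ Icc a b, 0 < w x) :
    IsLeast {v : ℝ | ∃ φ φ' : ℝ → ℝ,
        (∀ ξ ∈ Icc a b, HasDerivWithinAt φ (φ' ξ) (Icc a b) ξ) ∧
        IntervalIntegrable (fun ξ => (φ' ξ) ^ 2 * w ξ) volume a b ∧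
        φ a = -(1 / 2) ∧ φ b = 1 / 2 ∧ v = C * ∫ ξ in a..b, (φ' ξ) ^ 2 * w ξ}
      (C * (∫ ξ in a..b, (w ξ)⁻¹)⁻¹) := by
  set I := ∫ ξ in a..b, (w ξ)⁻¹ with hI
  have hinv : ContinuousOn (fun x => (w x)⁻¹) (Icc a b) := hw.inv₀ fun x hx => (hpos x hx).ne'
  have hinvI : IntervalIntegrable (fun x => (w x)⁻¹) volume a b :=
    hinv.intervalIntegrable_of_Icc hab.le
  have hIpos : 0 < I := intervalIntegral.intervalIntegral_pos_of_pos_on hinvI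
    (fun x hx => inv_pos.2 (hpos x (Ioo_subset_Icc_self hx))) hab
  constructor
  · have hsq : ∀ ξ ∈ uIcc a b, ((w ξ)⁻¹ / I) ^ 2 * w ξ = (w ξ)⁻¹ * (I⁻¹) ^ 2 := by
      intro ξ hξ
      rw [uIcc_of_le hab.le] at hξ
      have := (hpos ξ hξ).ne'
      field_simp
    refine ⟨fun x => -(1 / 2) + (∫ ξ in a..x, (w ξ)⁻¹) / I,
      fun x => (w x)⁻¹ / I, ?_, ?_, ?_, ?_, ?_⟩
    · intro x hx
      have : Fact (x ∈ Icc a b) := ⟨hx⟩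
      have hd : HasDerivWithinAt (fun u => ∫ ξ in a..u, (w ξ)⁻¹) ((w x)⁻¹) (Icc a b) x :=
        intervalIntegral.integral_hasDerivWithinAt_right
          (hinvI.mono_set (by
            rw [uIcc_of_le hab.le, uIcc_of_le hx.1]; exact Icc_subset_Icc_right hx.2))
          (hinv.stronglyMeasurableAtFilter_nhdsWithin measurableSet_Icc x) (hinv x hx)
      exact (hd.div_const I).const_add _
    · refine ContinuousOn.intervalIntegrable_of_Icc hab.le ?_
      exact ((hinv.div_const I).pow 2).mul hw
    · simp
    · beta_reduce
      rw [← hI, div_self hIpos.ne']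
      norm_num
    · rw [intervalIntegral.integral_congr hsq, intervalIntegral.integral_mul_const, ← hI]
      field_simp
  · rintro v ⟨φ, φ', hφ, hint, hφa, hφb, rfl⟩
    refine mul_le_mul_of_nonneg_left ?_ hC
    have hmaj : IntervalIntegrable
        (fun x => ((φ' x) ^ 2 * w x) * (I / 2) + (w x)⁻¹ * (I⁻¹ / 2)) volume a b :=
      (hint.mul_const _).add (hinvI.mul_const _)
    have h := intervalIntegral.sub_le_integral_of_hasDeriv_right_of_le hab.le
      (fun x hx => (hφ x hx).continuousWithinAt)
      (fun x hx => ((hφ x (Ioo_subset_Icc_self hx)).hasDerivAt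
        (Icc_mem_nhds hx.1 hx.2)).hasDerivWithinAt)
      ((intervalIntegrable_iff_integrableOn_Icc_of_le hab.le).1 hmaj)
      (fun x hx => by
        have hwx := hpos x (Ioo_subset_Icc_self hx)
        have hsq : ((φ' x) ^ 2 * w x) * (I / 2) + (w x)⁻¹ * (I⁻¹ / 2) - φ' x =
            (φ' x * w x * I - 1) ^ 2 / (2 * w x * I) := by
          field_simp
          ring
        have : 0 ≤ (φ' x * w x * I - 1) ^ 2 / (2 * w x * I) := by positivity
        linarith)
    rw [intervalIntegral.integral_add (hint.mul_const _) (hinvI.mul_const _),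
      intervalIntegral.integral_mul_const, intervalIntegral.integral_mul_const, ← hI, hφa, hφb] at h
    have h2 : I * (I⁻¹ / 2) = 1 / 2 := by field_simp
    rw [inv_le_iff_one_le_mul₀ hIpos]
    linarith

lemma intervalIntegral_neg_eq_two_mul_of_even {f : ℝ → ℝ} {a : ℝ} (heven : ∀ x, f (-x) = f x)
    (hf : IntervalIntegrable f volume 0 a) :
    ∫ x in (-a)..a, f x = 2 * ∫ x in (0 : ℝ)..a, f x := by
  have hneg : ∫ x in (-a)..0, f x = ∫ x in (0 : ℝ)..a, f x := by
    have := intervalIntegral.integral_comp_neg (a := 0) (b := a) f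
    simpa [heven] using this.symm
  have hf' : IntervalIntegrable f volume (-a) 0 := by
    simpa [heven, div_neg] using hf.symm.comp_mul_left (c := -1)
  rw [← intervalIntegral.integral_add_adjacent_intervals hf' hf, hneg, two_mul]

/-- With `τ_ε = ε e^{1/ε}`, the minimal transition cost
`k_ε = min { τ_ε ∫_{-1}^1 (φ')² dγ̃_ε : φ ∈ W^{1,2}(-1,1), φ(±1) = ±1/2 }`
satisfies `k_ε → √(|H''(0)| H''(1)) / (2π)` as `ε → 0⁺`. -/
theorem stmt4 (H : ℝ → ℝ)
    (hsmooth : ContDiffOn ℝ (⊤ : ℕ∞) H (Set.Icc (-1) 1))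
    (heven : ∀ ξ, H (-ξ) = H ξ)
    (h0 : H 0 = 1) (h1 : H 1 = 0) (hm1 : H (-1) = 0)
    (hpos : ∀ ξ ∈ Set.Ioo (-1:ℝ) 1, 0 < H ξ)
    (hmax : ∀ ξ ∈ Set.Icc (-1:ℝ) 1, ξ ≠ 0 → H ξ < 1)
    (hd1 : derivWithin H (Set.Icc (-1) 1) 1 = 0)
    (hdm1 : derivWithin H (Set.Icc (-1) 1) (-1) = 0)
    (hH20 : iteratedDerivWithin 2 H (Set.Icc (-1) 1) 0 < 0)
    (hH21 : 0 < iteratedDerivWithin 2 H (Set.Icc (-1) 1) 1) :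
    Tendsto (fun ε : ℝ => sInf {v : ℝ | ∃ φ φ' : ℝ → ℝ,
        (∀ ξ ∈ Set.Icc (-1:ℝ) 1, HasDerivWithinAt φ (φ' ξ) (Set.Icc (-1) 1) ξ) ∧
        IntervalIntegrable (fun ξ => (φ' ξ)^2 * Real.exp (-H ξ / ε)) volume (-1) 1 ∧
        φ (-1) = -(1/2) ∧ φ 1 = 1/2 ∧
        v = (ε * Real.exp (1/ε)) * (∫ ξ in (-1:ℝ)..1, Real.exp (-H ξ / ε))⁻¹ *
              ∫ ξ in (-1:ℝ)..1, (φ' ξ)^2 * Real.exp (-H ξ / ε)})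
      (nhdsWithin 0 (Set.Ioi 0))
      (nhds (Real.sqrt (|iteratedDerivWithin 2 H (Set.Icc (-1) 1) 0| *
          iteratedDerivWithin 2 H (Set.Icc (-1) 1) 1) / (2 * Real.pi))) := by
  have hcont : ContinuousOn H (Icc (-1) 1) := hsmooth.continuousOn
  have hC2 : ContDiffOn ℝ 2 H (Icc (-1) 1) := hsmooth.of_le (by
    exact WithTop.coe_le_coe.2 (le_top : (2 : ℕ∞) ≤ ⊤))
  have hsub : Icc (0 : ℝ) 1 ⊆ Icc (-1) 1 := Icc_subset_Icc_left (by norm_num)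
  set s : Set ℝ := Icc (-1) 1 with hs
  set A := iteratedDerivWithin 2 H s 0 with hA
  set B := iteratedDerivWithin 2 H s 1 with hB
  have hmem0 : s ∈ 𝓝 (0 : ℝ) := Icc_mem_nhds (by norm_num) (by norm_num)
  have hd0 : derivWithin H s 0 = 0 := by
    rw [derivWithin_of_mem_nhds hmem0]
    refine IsLocalMax.deriv_eq_zero ?_
    filter_upwards [hmem0] with x hx
    rcases eq_or_ne x 0 with rfl | hx0
    · exact le_rfl
    · rw [h0]
      exact (hmax x hx hx0).le
  have hIoo : Ioo (0 : ℝ) 1 ∈ 𝓝[>] (0 : ℝ) := Ioo_mem_nhdsGT one_pos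
  have hlim0 : Tendsto (fun x => (1 - H x) / x ^ 2) (𝓝[>] 0) (𝓝 (|A| / 2)) := by
    have h := tendsto_sub_div_sq_of_derivWithin_eq_zero (convex_Icc (-1 : ℝ) 1)
      (hsub ⟨le_rfl, zero_le_one⟩) hC2 hd0
    have hid : Tendsto (fun x : ℝ => x) (𝓝[>] 0) (𝓝[s \ {0}] 0) := by
      refine tendsto_nhdsWithin_iff.2 ⟨nhdsWithin_le_nhds, ?_⟩
      filter_upwards [hIoo] with x hx
      exact ⟨hsub (Ioo_subset_Icc_self hx), hx.1.ne'⟩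
    have h' := (h.comp hid).neg
    rw [abs_of_neg hH20, neg_div]
    refine h'.congr fun x => ?_
    simp only [Function.comp, h0, sub_zero]
    ring
  have hlim1 : Tendsto (fun x => H (1 - x) / x ^ 2) (𝓝[>] 0) (𝓝 (B / 2)) := by
    have h := tendsto_sub_div_sq_of_derivWithin_eq_zero (convex_Icc (-1 : ℝ) 1)
      (hsub ⟨zero_le_one, le_rfl⟩) hC2 hd1
    have hrefl : Tendsto (fun x : ℝ => 1 - x) (𝓝[>] 0) (𝓝[s \ {1}] 1) := by
      refine tendsto_nhdsWithin_iff.2 ⟨?_, ?_⟩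
      · have : Tendsto (fun x : ℝ => 1 - x) (𝓝 0) (𝓝 (1 - 0)) := by
          exact (by fun_prop : Continuous fun x : ℝ => 1 - x).tendsto 0
        rw [sub_zero] at this
        exact this.mono_left nhdsWithin_le_nhds
      · filter_upwards [hIoo] with x hx
        refine ⟨hsub ⟨by linarith [hx.2], by linarith [hx.1]⟩, ?_⟩
        have := hx.1
        simp only [mem_singleton_iff]
        linarith
    refine (h.comp hrefl).congr fun x => ?_
    simp only [Function.comp, h1, sub_zero]
    ring
  have hL0 := tendsto_laplace_half (f := fun x => 1 - H x) (half_pos (abs_pos.2 hH20.ne))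
    (continuousOn_const.sub (hcont.mono hsub))
    (fun x hx => sub_pos.2 (hmax x (hsub (Ioc_subset_Icc_self hx)) hx.1.ne')) hlim0
  have hL1 := tendsto_laplace_half (f := fun x => H (1 - x)) (half_pos hH21)
    (hcont.comp (by fun_prop) fun x hx => ⟨by linarith [hx.2], by linarith [hx.1]⟩)
    (fun x hx => hpos _ ⟨by linarith [hx.2], by linarith [hx.1]⟩) hlim1
  have hne : ∀ c : ℝ, 0 < c → 2 * (√(Real.pi / c) / 2) ≠ 0 := fun c hc => by
    have := Real.sqrt_pos.2 (div_pos Real.pi_pos hc)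
    positivity
  have hprod := ((hL1.const_mul 2).inv₀ (hne _ (half_pos hH21))).mul
    ((hL0.const_mul 2).inv₀ (hne _ (half_pos (abs_pos.2 hH20.ne))))
  have hval : (2 * (√(Real.pi / (B / 2)) / 2))⁻¹ * (2 * (√(Real.pi / (|A| / 2)) / 2))⁻¹ =
      √(|A| * B) / (2 * Real.pi) := by
    have hA' : 0 < |A| := abs_pos.2 hH20.ne
    have hpi := Real.pi_pos
    rw [mul_div_cancel₀ _ two_ne_zero, mul_div_cancel₀ _ two_ne_zero, ← mul_inv,
      ← Real.sqrt_mul (by positivity), ← Real.sqrt_inv]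
    rw [show (Real.pi / (B / 2) * (Real.pi / (|A| / 2)))⁻¹ = (|A| * B) / (2 * Real.pi) ^ 2 by
      field_simp, Real.sqrt_div (by positivity), Real.sqrt_sq (by positivity)]
  rw [hval] at hprod
  refine hprod.congr' ?_
  filter_upwards [self_mem_nhdsWithin] with ε hε
  have hε0 : (0 : ℝ) < ε := hε
  have hwc : ContinuousOn (fun ξ => Real.exp (-H ξ / ε)) s :=
    Real.continuous_exp.comp_continuousOn (hcont.neg.div_const ε)
  have hZ0 : 0 ≤ ∫ ξ in (-1 : ℝ)..1, Real.exp (-H ξ / ε) :=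
    intervalIntegral.integral_nonneg (by norm_num) fun _ _ => (Real.exp_pos _).le
  rw [(isLeast_weighted_energy (by norm_num) (by positivity) hwc
    fun _ _ => Real.exp_pos _).csInf_eq]
  have hZ : ∫ ξ in (-1 : ℝ)..1, Real.exp (-H ξ / ε) =
      2 * ∫ x in (0 : ℝ)..1, Real.exp (-H (1 - x) / ε) := by
    rw [intervalIntegral_neg_eq_two_mul_of_even (fun x => by rw [heven])
      ((hwc.mono hsub).intervalIntegrable_of_Icc zero_le_one)]
    rw [intervalIntegral.integral_comp_sub_left (fun x => Real.exp (-H x / ε)) 1]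
    simp
  have hI : ∫ ξ in (-1 : ℝ)..1, (Real.exp (-H ξ / ε))⁻¹ =
      Real.exp (1 / ε) * (2 * ∫ x in (0 : ℝ)..1, Real.exp (-(1 - H x) / ε)) := by
    rw [intervalIntegral_neg_eq_two_mul_of_even
      (f := fun ξ => (Real.exp (-H ξ / ε))⁻¹) (fun x => by simp only [heven])
      (((hwc.inv₀ fun x _ => (Real.exp_pos _).ne').mono hsub).intervalIntegrable_of_Icc
        zero_le_one), mul_left_comm, ← intervalIntegral.integral_const_mul (Real.exp (1 / ε))]
    refine congrArg ((2 : ℝ) * ·) (intervalIntegral.integral_congr fun x _ => ?_)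
    rw [← Real.exp_neg, ← Real.exp_add]
    congr 1
    ring
  rw [hZ, hI]
  simp only [mul_inv, inv_inv]
  have hss : √ε * √ε = ε := Real.mul_self_sqrt hε0.le
  have hee : Real.exp (1 / ε) * (Real.exp (1 / ε))⁻¹ = 1 := mul_inv_cancel₀ (Real.exp_pos _).ne'
  set X := (∫ x in (0 : ℝ)..1, Real.exp (-H (1 - x) / ε))⁻¹
  set Y := (∫ x in (0 : ℝ)..1, Real.exp (-(1 - H x) / ε))⁻¹
  calc 2⁻¹ * (√ε * X) * (2⁻¹ * (√ε * Y)) = (√ε * √ε) * 1 * (2⁻¹ * X) * (2⁻¹ * Y) := by ring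
    _ = ε * (Real.exp (1 / ε) * (Real.exp (1 / ε))⁻¹) * (2⁻¹ * X) * (2⁻¹ * Y) := by rw [hss, hee]
    _ = _ := by ring
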